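/- arXiv:2005.13069 — 9 statements merged into one kernel-verified Lean document; each statement's English description precedes it below -/
import Mathlib

section
/- For every real b, the characteristic polynomial of the 6×6 real matrix B(b) equals (X² − (1−b²))·(X² − 9(1−b²))·(X² − 25(1−b²)). -/
open Polynomial Matrix

/-- The perturbed Hamiltonian `H(a,b,c)` of Eq. (9) of the paper, specialized to
`a = 0`, `c = 5b`. -/
def Bmat (b : ℝ) : Matrix (Fin 6) (Fin 6) ℝ :=
  !![-5, 0, 0, 0, 0, 5 * b;
     0, -3, 0, 0, -3 * b, 0;
     0, 0, -1, b, 0, 0;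
     0, 0, -b, 1, 0, 0;
     0, 3 * b, 0, 0, 3, 0;
     -5 * b, 0, 0, 0, 0, 5]

/-- The characteristic polynomial of `B(b)` factors as
`(X² − (1−b²))·(X² − 9(1−b²))·(X² − 25(1−b²))`. -/
theorem charpoly_Bmat (b : ℝ) :
    (Bmat b).charpoly =
      (X ^ 2 - C (1 - b ^ 2)) * (X ^ 2 - C (9 * (1 - b ^ 2))) *
        (X ^ 2 - C (25 * (1 - b ^ 2))) := by
  have h_ofNat (n : ℕ) [n.AtLeastTwo] : (C (OfNat.ofNat n : ℝ) : ℝ[X]) = OfNat.ofNat n :=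
    map_ofNat C n
  have h : (Bmat b).charmatrix =
      !![X + 5, 0, 0, 0, 0, -(5 * C b);
         0, X + 3, 0, 0, 3 * C b, 0;
         0, 0, X + 1, -C b, 0, 0;
         0, 0, C b, X - 1, 0, 0;
         0, -(3 * C b), 0, 0, X - 3, 0;
         5 * C b, 0, 0, 0, 0, X - 5] := by
    ext1 i j
    fin_cases i <;> fin_cases j <;> simp [Bmat, h_ofNat]
  rw [Matrix.charpoly, h]
  simp [det_succ_row_zero, Fin.sum_univ_succ, Fin.succAbove, h_ofNat]
  ring
end

section
/- At the critical parameter values b = 1 and b = −1, the 6×6 real matrix B(b) satisfies B(b)² = 0 and rank B(b) = 3; i.e., all six eigenvalues coalesce at 0, the eigenvalue 0 having algebraic multiplicity 6 and geometric multiplicity 3 (a triply degenerate second-order exceptional point EP2+EP2+EP2). -/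
open Matrix

theorem Bmat_sq_eq_zero {b : ℝ} (hb : b ^ 2 = 1) : Bmat b ^ 2 = 0 := by
  rw [sq]
  ext i j
  fin_cases i <;> fin_cases j <;>
    simp [Bmat, Matrix.mul_apply, Fin.sum_univ_six] <;> grind

/-- The upper left `3 × 3` block of `Bmat b` is invertible for every `b`. -/
theorem three_le_rank_Bmat (b : ℝ) : 3 ≤ (Bmat b).rank := by
  have hdet : ((Bmat b).submatrix (Fin.castLE (by decide : 3 ≤ 6))
      (Fin.castLE (by decide : 3 ≤ 6))).det ≠ 0 := by
    simp [Matrix.det_fin_three, Bmat, Fin.castLE]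
  simpa [Matrix.rank_of_det_ne_zero hdet] using
    (Bmat b).rank_submatrix_le (Fin.castLE (by decide : 3 ≤ 6)) (Fin.castLE (by decide : 3 ≤ 6))

/-- At the critical values `b = ±1`, the matrix `B(b)` satisfies `B(b)² = 0` and
`rank B(b) = 3`: all six eigenvalues coalesce at `0`, with algebraic multiplicity 6
and geometric multiplicity 3 (a triply degenerate exceptional point EP2+EP2+EP2). -/
theorem Bmat_critical (b : ℝ) (hb : b = 1 ∨ b = -1) :
    (Bmat b) ^ 2 = 0 ∧ (Bmat b).rank = 3 := by
  have hsq : Bmat b ^ 2 = 0 := Bmat_sq_eq_zero (by rcases hb with rfl | rfl <;> norm_num)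
  have hle := Matrix.rank_add_rank_le_card_of_mul_eq_zero (sq (Bmat b) ▸ hsq)
  rw [Fintype.card_fin] at hle
  have hge := three_le_rank_Bmat b
  exact ⟨hsq, by omega⟩
end

section
/- For every real b with |b| > 1, the 6×6 real matrix B(b), viewed as a complex matrix, has no real eigenvalues; its spectrum consists of the six distinct purely imaginary numbers ±i√(b²−1), ±3i√(b²−1), ±5i√(b²−1). -/
open Matrix Complex

/-- The characteristic polynomial of `B(b)` factors over its three `2 × 2` blocks. -/
lemma det_algebraMap_sub_Bmat (b : ℝ) (z : ℂ) :
    (algebraMap ℂ (Matrix (Fin 6) (Fin 6) ℂ) z - (Bmat b).map Complex.ofReal).det =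
      (z ^ 2 + (b ^ 2 - 1)) * (z ^ 2 + 9 * (b ^ 2 - 1)) * (z ^ 2 + 25 * (b ^ 2 - 1)) := by
  have h : algebraMap ℂ (Matrix (Fin 6) (Fin 6) ℂ) z - (Bmat b).map Complex.ofReal =
      !![z + 5, 0, 0, 0, 0, -(5 * b);
         0, z + 3, 0, 0, 3 * b, 0;
         0, 0, z + 1, -b, 0, 0;
         0, 0, b, z - 1, 0, 0;
         0, -(3 * b), 0, 0, z - 3, 0;
         5 * b, 0, 0, 0, 0, z - 5] := by
    ext i j
    fin_cases i <;> fin_cases j <;> simp [Bmat, Matrix.algebraMap_matrix_apply]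
  rw [h]
  simp [Matrix.det_succ_row_zero, Fin.sum_univ_succ, Fin.succAbove]
  ring

/-- The spectrum of `B(b)` in terms of any complex square root `w` of `1 - b²`. -/
lemma mem_spectrum_Bmat_iff (b : ℝ) {w : ℂ} (hw : w ^ 2 = -(b ^ 2 - 1)) (z : ℂ) :
    z ∈ spectrum ℂ ((Bmat b).map Complex.ofReal) ↔
      z = w ∨ z = -w ∨ z = 3 * w ∨ z = -(3 * w) ∨ z = 5 * w ∨ z = -(5 * w) := by
  have hdet : (z ^ 2 + (b ^ 2 - 1)) * (z ^ 2 + 9 * (b ^ 2 - 1)) * (z ^ 2 + 25 * (b ^ 2 - 1)) =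
      (z ^ 2 - w ^ 2) * (z ^ 2 - (3 * w) ^ 2) * (z ^ 2 - (5 * w) ^ 2) := by
    rw [mul_pow, mul_pow, hw]
    ring
  rw [spectrum.mem_iff, Matrix.isUnit_iff_isUnit_det, isUnit_iff_ne_zero, not_not,
    det_algebraMap_sub_Bmat, hdet]
  simp only [mul_eq_zero, sub_eq_zero, sq_eq_sq_iff_eq_or_eq_neg, or_assoc]

/-- For `|b| > 1`, the matrix `B(b)` (viewed as a complex matrix) has no real
eigenvalues: its spectrum consists of the six distinct purely imaginary numbers
`±i√(b²−1)`, `±3i√(b²−1)`, `±5i√(b²−1)`. -/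
theorem spectrum_Bmat_broken (b : ℝ) (hb : 1 < |b|) :
    (∀ z ∈ spectrum ℂ ((Bmat b).map (Complex.ofReal)), z.im ≠ 0) ∧
    spectrum ℂ ((Bmat b).map (Complex.ofReal)) =
      {Complex.I * Real.sqrt (b ^ 2 - 1), -(Complex.I * Real.sqrt (b ^ 2 - 1)),
       3 * Complex.I * Real.sqrt (b ^ 2 - 1), -(3 * Complex.I * Real.sqrt (b ^ 2 - 1)),
       5 * Complex.I * Real.sqrt (b ^ 2 - 1), -(5 * Complex.I * Real.sqrt (b ^ 2 - 1))} ∧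
    ({Complex.I * Real.sqrt (b ^ 2 - 1), -(Complex.I * Real.sqrt (b ^ 2 - 1)),
       3 * Complex.I * Real.sqrt (b ^ 2 - 1), -(3 * Complex.I * Real.sqrt (b ^ 2 - 1)),
       5 * Complex.I * Real.sqrt (b ^ 2 - 1), -(5 * Complex.I * Real.sqrt (b ^ 2 - 1))} :
        Finset ℂ).card = 6 := by
  have hpos : 0 < b ^ 2 - 1 := sub_pos.mpr ((one_lt_sq_iff_one_lt_abs b).mpr hb)
  have hs : 0 < Real.sqrt (b ^ 2 - 1) := Real.sqrt_pos.mpr hpos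
  have hw : (Complex.I * Real.sqrt (b ^ 2 - 1)) ^ 2 = -((b : ℂ) ^ 2 - 1) := by
    rw [mul_pow, Complex.I_sq, ← Complex.ofReal_pow, Real.sq_sqrt hpos.le]
    push_cast
    ring
  have hmem := mem_spectrum_Bmat_iff b hw
  generalize Real.sqrt (b ^ 2 - 1) = s at *
  refine ⟨fun z hz => ?_, ?_, ?_⟩
  · rcases (hmem z).mp hz with rfl | rfl | rfl | rfl | rfl | rfl <;> simp [hs.ne']
  · ext z
    simp only [hmem, Set.mem_insert_iff, Set.mem_singleton_iff, mul_assoc]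
  · have hinj : Function.Injective fun k : ℤ => (k : ℂ) * (Complex.I * s) := fun k l h =>
      Int.cast_injective (mul_right_cancel₀ (by simp [hs.ne']) h)
    have himage := Finset.card_image_of_injective ({1, -1, 3, -3, 5, -5} : Finset ℤ) hinj
    simpa [Finset.image_insert, mul_assoc] using himage
end

section
/- The 6×6 real matrix C is nilpotent with C⁴ = 0 and C³ ≠ 0, and rank C = 4; equivalently, C has the single eigenvalue 0 with algebraic multiplicity 6 and geometric multiplicity 2 (an EP4 + EP2 degeneracy). -/
open Matrix

/-- The EP4+EP2 Hamiltonian of Eq. (12) of the paper. -/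
noncomputable def Cmat : Matrix (Fin 6) (Fin 6) ℝ :=
  !![-9, 3 * Real.sqrt 3, 0, 0, 0, 0;
     -3 * Real.sqrt 3, -3, 0, 0, 6, 0;
     0, 0, -1, 1, 0, 0;
     0, 0, -1, 1, 0, 0;
     0, -6, 0, 0, 3, 3 * Real.sqrt 3;
     0, 0, 0, 0, -3 * Real.sqrt 3, 9]

theorem Cmat_sq : Cmat ^ 2 =
    !![54, -36 * Real.sqrt 3, 0, 0, 18 * Real.sqrt 3, 0;
       36 * Real.sqrt 3, -54, 0, 0, 0, 18 * Real.sqrt 3;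
       0, 0, 0, 0, 0, 0;
       0, 0, 0, 0, 0, 0;
       18 * Real.sqrt 3, 0, 0, 0, -54, 36 * Real.sqrt 3;
       0, 18 * Real.sqrt 3, 0, 0, -36 * Real.sqrt 3, 54] := by
  have hs : Real.sqrt 3 * Real.sqrt 3 = 3 := Real.mul_self_sqrt (by norm_num)
  ext i j
  fin_cases i <;> fin_cases j <;>
    simp [Cmat, sq, Matrix.mul_apply, Fin.sum_univ_succ] <;> linarith

theorem Cmat_pow_four : Cmat ^ 4 = 0 := by
  have hs : Real.sqrt 3 * Real.sqrt 3 = 3 := Real.mul_self_sqrt (by norm_num)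
  rw [show 4 = 2 * 2 from rfl, pow_mul, Cmat_sq]
  ext i j
  fin_cases i <;> fin_cases j <;>
    simp [sq, Matrix.mul_apply, Fin.sum_univ_succ] <;> linarith

theorem Cmat_pow_three_apply_zero_zero : (Cmat ^ 3) 0 0 = -162 := by
  have hs : Real.sqrt 3 * Real.sqrt 3 = 3 := Real.mul_self_sqrt (by norm_num)
  rw [pow_succ, Cmat_sq]
  simp [Cmat, Matrix.mul_apply, Fin.sum_univ_succ]
  linarith

/-- The rows of `C` are combinations of its rows `0, 1, 2, 4`. -/
theorem Cmat_eq_mul_submatrix : Cmat =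
    !![1, 0, 0, 0;
       0, 1, 0, 0;
       0, 0, 1, 0;
       0, 0, 1, 0;
       0, 0, 0, 1;
       1, -Real.sqrt 3, 0, Real.sqrt 3] * Cmat.submatrix ![0, 1, 2, 4] id := by
  have hs : Real.sqrt 3 * Real.sqrt 3 = 3 := Real.mul_self_sqrt (by norm_num)
  ext i j
  rw [Matrix.mul_apply, Fin.sum_univ_four]
  fin_cases i <;> fin_cases j <;> simp [Cmat] <;> linarith

/-- The minor on rows `0, 1, 2, 4` and columns `1, 4, 3, 5` is lower triangular. -/
theorem det_Cmat_submatrix :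
    (Cmat.submatrix ![0, 1, 2, 4] ![1, 4, 3, 5]).det = 162 := by
  have hs : Real.sqrt 3 * Real.sqrt 3 = 3 := Real.mul_self_sqrt (by norm_num)
  rw [Matrix.det_of_isLowerTriangular]
  · simp [Cmat, Fin.prod_univ_succ]
    linarith
  · intro i j hij
    replace hij : i < j := hij
    fin_cases i <;> fin_cases j <;> simp [Cmat] at hij ⊢

theorem rank_Cmat : Cmat.rank = 4 := by
  apply le_antisymm
  · rw [Cmat_eq_mul_submatrix]
    exact (Matrix.rank_mul_le_right _ _).trans (Matrix.rank_le_height _)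
  · have hunit : IsUnit (Cmat.submatrix ![0, 1, 2, 4] ![1, 4, 3, 5]) := by
      rw [Matrix.isUnit_iff_isUnit_det, det_Cmat_submatrix]
      norm_num
    calc
      4 = (Cmat.submatrix ![0, 1, 2, 4] ![1, 4, 3, 5]).rank := by
        rw [Matrix.rank_of_isUnit _ hunit, Fintype.card_fin]
      _ ≤ Cmat.rank := Matrix.rank_submatrix_le _ _ _

/-- `C` is nilpotent with `C⁴ = 0`, `C³ ≠ 0`, and `rank C = 4`: the single eigenvalue
`0` has algebraic multiplicity 6 and geometric multiplicity 2 (an EP4+EP2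
degeneracy). -/
theorem Cmat_nilpotent : Cmat ^ 4 = 0 ∧ Cmat ^ 3 ≠ 0 ∧ Cmat.rank = 4 := by
  refine ⟨Cmat_pow_four, fun h => ?_, rank_Cmat⟩
  have h00 := Cmat_pow_three_apply_zero_zero
  norm_num [h] at h00
end

section
/- For every real τ with 0 ≤ τ ≤ 1, the characteristic polynomial of the 6×6 real matrix D(τ, 0) equals X⁶ − 91τ·X⁴ + 819τ²·X² − 729τ³. -/
open Polynomial Matrix

/-- The two-parametric Hamiltonian `H⁽⁶⁾(τ,β)` of Eq. (13) of the paper. -/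
noncomputable def Dmat (τ β : ℝ) : Matrix (Fin 6) (Fin 6) ℝ :=
  !![-9, 3 * Real.sqrt (3 - 3 * τ), 0, 0, 0, 0;
     -3 * Real.sqrt (3 - 3 * τ), -3, Real.sqrt β, 0, -6 * Real.sqrt (1 - τ), 0;
     0, -Real.sqrt β, -1, Real.sqrt (1 - τ), 0, 0;
     0, 0, -Real.sqrt (1 - τ), 1, Real.sqrt β, 0;
     0, 6 * Real.sqrt (1 - τ), 0, -Real.sqrt β, 3, 3 * Real.sqrt (3 - 3 * τ);
     0, 0, 0, 0, -3 * Real.sqrt (3 - 3 * τ), 9]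

/-- The determinant of a `6 × 6` matrix which decouples into a tridiagonal `4 × 4` block on the
indices `0, 1, 4, 5` and a `2 × 2` block on the indices `2, 3`. -/
lemma det_decoupled_tridiagonal {R : Type*} [CommRing R]
    (d₀ d₁ d₂ d₃ d₄ d₅ a a' b b' c c' e e' : R) :
    det !![d₀, a, 0, 0, 0, 0;
           a', d₁, 0, 0, b, 0;
           0, 0, d₂, e, 0, 0;
           0, 0, e', d₃, 0, 0;
           0, b', 0, 0, d₄, c;
           0, 0, 0, 0, c', d₅] =
      (d₂ * d₃ - e * e') *
        ((d₀ * d₁ - a * a') * (d₄ * d₅ - c * c') - d₀ * d₅ * (b * b')) := by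
  simp [det_succ_row_zero, Fin.sum_univ_succ, Fin.succAbove]
  ring

/-- For `τ ∈ [0,1]`, the characteristic polynomial of `D(τ,0)` equals
`X⁶ − 91τ·X⁴ + 819τ²·X² − 729τ³`. -/
theorem charpoly_Dmat_beta_zero (τ : ℝ) (hτ : 0 ≤ τ) (hτ' : τ ≤ 1) :
    (Dmat τ 0).charpoly =
      X ^ 6 - C (91 * τ) * X ^ 4 + C (819 * τ ^ 2) * X ^ 2 - C (729 * τ ^ 3) := by
  have ha : (C √(3 - 3 * τ) : ℝ[X]) ^ 2 = 3 - 3 * C τ := by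
    rw [← C_pow, Real.sq_sqrt (by linarith), map_sub, map_mul, map_ofNat]
  have hb : (C √(1 - τ) : ℝ[X]) ^ 2 = 1 - C τ := by
    rw [← C_pow, Real.sq_sqrt (by linarith), map_sub, map_one]
  generalize hu : (C √(3 - 3 * τ) : ℝ[X]) = u at ha
  generalize hv : (C √(1 - τ) : ℝ[X]) = v at hb
  have hM : (Dmat τ 0).charmatrix =
      !![X + 9, -(3 * u), 0, 0, 0, 0;
         3 * u, X + 3, 0, 0, 6 * v, 0;
         0, 0, X + 1, -v, 0, 0;
         0, 0, v, X - 1, 0, 0;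
         0, -(6 * v), 0, 0, X - 3, -(3 * u);
         0, 0, 0, 0, 3 * u, X - 9] := by
    subst hu hv
    ext1 i j
    fin_cases i <;> fin_cases j <;> simp [Dmat, map_ofNat C]
  rw [charpoly, hM, det_decoupled_tridiagonal]
  have hu2 : -(3 * u) * (3 * u) = -9 * (3 - 3 * C τ) := by linear_combination -9 * ha
  have hv2 : -v * v = -(1 - C τ) := by linear_combination -hb
  have hw2 : 6 * v * -(6 * v) = -36 * (1 - C τ) := by linear_combination -36 * hb
  rw [hu2, hv2, hw2]
  simp only [map_mul, map_pow, map_ofNat]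
  ring
end

section
/- For every real τ with 0 < τ ≤ 1, the spectrum of the 6×6 real matrix D(τ, 0) consists of exactly the six distinct real numbers ±√τ, ±3√τ, ±9√τ; as τ → 0 all six eigenvalues merge at the exceptional-point value 0. -/
open Matrix Filter

theorem det_scalar_sub_Dmat_beta_zero {τ : ℝ} (hτ : τ ≤ 1) (x : ℝ) :
    (algebraMap ℝ (Matrix (Fin 6) (Fin 6) ℝ) x - Dmat τ 0).det =
      (x ^ 2 - τ) * (x ^ 2 - 9 * τ) * (x ^ 2 - 81 * τ) := by
  have hr : Real.sqrt (3 - 3 * τ) ^ 2 = 3 - 3 * τ := Real.sq_sqrt (by linarith)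
  have hs : Real.sqrt (1 - τ) ^ 2 = 1 - τ := Real.sq_sqrt (by linarith)
  have hM : algebraMap ℝ (Matrix (Fin 6) (Fin 6) ℝ) x - Dmat τ 0 =
      !![x + 9, -(3 * Real.sqrt (3 - 3 * τ)), 0, 0, 0, 0;
         3 * Real.sqrt (3 - 3 * τ), x + 3, 0, 0, 6 * Real.sqrt (1 - τ), 0;
         0, 0, x + 1, -Real.sqrt (1 - τ), 0, 0;
         0, 0, Real.sqrt (1 - τ), x - 1, 0, 0;
         0, -(6 * Real.sqrt (1 - τ)), 0, 0, x - 3, -(3 * Real.sqrt (3 - 3 * τ));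
         0, 0, 0, 0, 3 * Real.sqrt (3 - 3 * τ), x - 9] := by
    ext i j
    fin_cases i <;> fin_cases j <;> simp [Dmat, Matrix.algebraMap_matrix_apply]
  rw [hM]
  generalize Real.sqrt (3 - 3 * τ) = r at hr ⊢
  generalize Real.sqrt (1 - τ) = s at hs ⊢
  simp [Matrix.det_succ_row_zero, Fin.sum_univ_succ, Fin.succAbove]
  obtain rfl : τ = 1 - s ^ 2 := by linarith
  have hr' : r ^ 2 = 3 * s ^ 2 := by linarith
  grind

/-- For `0 < τ ≤ 1` the spectrum of `D(τ,0)` consists of exactly the six distinct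
real numbers `±√τ, ±3√τ, ±9√τ`; as `τ → 0⁺` all six eigenvalues merge at the
exceptional-point value `0`. -/
theorem spectrum_Dmat_beta_zero (τ : ℝ) (hτ : 0 < τ) (hτ' : τ ≤ 1) :
    spectrum ℝ (Dmat τ 0) =
      {Real.sqrt τ, -Real.sqrt τ, 3 * Real.sqrt τ, -(3 * Real.sqrt τ),
       9 * Real.sqrt τ, -(9 * Real.sqrt τ)} ∧
    ({Real.sqrt τ, -Real.sqrt τ, 3 * Real.sqrt τ, -(3 * Real.sqrt τ),
       9 * Real.sqrt τ, -(9 * Real.sqrt τ)} : Finset ℝ).card = 6 ∧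
    ∀ c ∈ ({1, -1, 3, -3, 9, -9} : Set ℝ),
      Tendsto (fun t : ℝ => c * Real.sqrt t) (nhdsWithin 0 (Set.Ioi 0)) (nhds 0) := by
  have hq : Real.sqrt τ ^ 2 = τ := Real.sq_sqrt hτ.le
  have hpos : 0 < Real.sqrt τ := Real.sqrt_pos.2 hτ
  refine ⟨?_, ?_, fun c _ => ?_⟩
  · ext x
    have hfactor : (x ^ 2 - τ) * (x ^ 2 - 9 * τ) * (x ^ 2 - 81 * τ) =
        (x - √τ) * (x + √τ) * (x - 3 * √τ) * (x + 3 * √τ) * (x - 9 * √τ) * (x + 9 * √τ) := by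
      rw [← hq, Real.sqrt_sq hpos.le]
      ring
    rw [spectrum.mem_iff, Matrix.isUnit_iff_isUnit_det, isUnit_iff_ne_zero, not_not,
      det_scalar_sub_Dmat_beta_zero hτ', hfactor]
    simp only [mul_eq_zero, sub_eq_zero, add_eq_zero_iff_eq_neg, or_assoc,
      Set.mem_insert_iff, Set.mem_singleton_iff]
  · repeat rw [Finset.card_insert_of_notMem (by
      simp only [Finset.mem_insert, Finset.mem_singleton, not_or]
      grind)]
    simp
  · have h : Tendsto (fun t : ℝ => c * √t) (nhds 0) (nhds (c * √0)) :=
      (Real.continuous_sqrt.const_mul c).tendsto 0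
    rw [Real.sqrt_zero, mul_zero] at h
    exact h.mono_left nhdsWithin_le_nhds
end

section
/- For all real τ ∈ [0,1] and β ≥ 0, the characteristic polynomial of the 6×6 real matrix D(τ, β) is even in X and equals q(X²), where q(s) = s³ + (2β − 91τ)·s² + (β² − 42τβ − 114β + 819τ²)·s − (729τ³ + 486τβ + 81β²); i.e., E is an eigenvalue of D(τ, β) if and only if s = E² is a root of the cubic q. -/
open Polynomial Matrix

/-- The cubic secular polynomial `q` of Eq. (14) of the paper. -/
noncomputable def qPoly (τ β : ℝ) : Polynomial ℝ :=
  X ^ 3 + C (2 * β - 91 * τ) * X ^ 2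
    + C (β ^ 2 - 42 * τ * β - 114 * β + 819 * τ ^ 2) * X
    - C (729 * τ ^ 3 + 486 * τ * β + 81 * β ^ 2)

/-- The characteristic determinant of `D(τ,β)` in terms of `a = √(1 - τ)`, `b = √β` and
`c = √(3 - 3τ)`. -/
theorem det_sub_of_sq_eq {R : Type*} [CommRing R] (a b c x : R) (hc : c ^ 2 = 3 * a ^ 2) :
    (!![x + 9, -(3 * c), 0, 0, 0, 0;
        3 * c, x + 3, -b, 0, 6 * a, 0;
        0, b, x + 1, -a, 0, 0;
        0, 0, a, x - 1, -b, 0;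
        0, -(6 * a), 0, b, x - 3, -(3 * c);
        0, 0, 0, 0, 3 * c, x - 9] : Matrix (Fin 6) (Fin 6) R).det =
      x ^ 6 + (2 * b ^ 2 - 91 * (1 - a ^ 2)) * x ^ 4
        + (b ^ 4 - 42 * (1 - a ^ 2) * b ^ 2 - 114 * b ^ 2 + 819 * (1 - a ^ 2) ^ 2) * x ^ 2
        - (729 * (1 - a ^ 2) ^ 3 + 486 * (1 - a ^ 2) * b ^ 2 + 81 * b ^ 4) := by
  simp [Matrix.det_succ_row_zero, Fin.sum_univ_succ, Fin.succAbove]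
  linear_combination
    (9 * ((x - 9) * ((x + 1) * (x - 1) * (x - 3) + a ^ 2 * (x - 3) + b ^ 2 * (x + 1))
        + (x + 9) * ((x + 3) * (x + 1) * (x - 1) + b ^ 2 * (x - 1) + a ^ 2 * (x + 3)))
      + 81 * ((x + 1) * (x - 1) + a ^ 2) * (c ^ 2 + 3 * a ^ 2)) * hc

/-- For `τ ∈ [0,1]` and `β ≥ 0`, the characteristic polynomial of `D(τ,β)` is even in
`X` and equals `q(X²)`; hence `E` is an eigenvalue of `D(τ,β)` iff `s = E²` is a root
of the cubic `q`. -/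
theorem charpoly_Dmat (τ β : ℝ) (hτ : 0 ≤ τ) (hτ' : τ ≤ 1) (hβ : 0 ≤ β) :
    (Dmat τ β).charpoly = (qPoly τ β).comp (X ^ 2) ∧
    ∀ E : ℝ, E ∈ spectrum ℝ (Dmat τ β) ↔ (qPoly τ β).eval (E ^ 2) = 0 := by
  have hchar : (Dmat τ β).charpoly = (qPoly τ β).comp (X ^ 2) := by
    refine Polynomial.funext fun x => ?_
    have ha : √(1 - τ) ^ 2 = 1 - τ := Real.sq_sqrt (by linarith)
    have hb : √β ^ 2 = β := Real.sq_sqrt hβ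
    have hc : √(3 - 3 * τ) ^ 2 = 3 * √(1 - τ) ^ 2 := by
      rw [ha, Real.sq_sqrt (by linarith)]
      ring
    have hdet := det_sub_of_sq_eq √(1 - τ) √β √(3 - 3 * τ) x hc
    rw [show √β ^ 4 = (√β ^ 2) ^ 2 by ring, ha, hb] at hdet
    rw [Matrix.eval_charpoly]
    refine (congrArg Matrix.det ?_).trans (hdet.trans ?_)
    · ext i j
      fin_cases i <;> fin_cases j <;> simp [Dmat]
    · simp [qPoly]
      ring
  refine ⟨hchar, fun E => ?_⟩
  rw [Matrix.mem_spectrum_iff_isRoot_charpoly, hchar, IsRoot.def, eval_comp, eval_pow, eval_X]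
end

section
/- For every real γ ≠ 0, the 6×6 real matrix E(γ) is similar to the single 6×6 Jordan block J₆(0); in particular E(γ)⁶ = 0, E(γ)⁵ ≠ 0, and rank E(γ) = 5 (geometric multiplicity of the eigenvalue 0 equals 1), whereas at γ = 0 one has E(0)⁴ = 0 and rank E(0) = 4 (geometric multiplicity 2); i.e., the type of the exceptional-point degeneracy changes abruptly from EP6 to EP4+EP2 in the limit γ → 0. -/
open Matrix

/-- The minimalistically perturbed Hamiltonian of Eq. (15) of the paper. -/
noncomputable def Emat (γ : ℝ) : Matrix (Fin 6) (Fin 6) ℝ :=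
  !![-9, 3 * Real.sqrt 3, 0, 0, 0, 0;
     -3 * Real.sqrt 3, -3, 0, 0, 6, 0;
     0, 0, -1, 1, 0, 0;
     0, 0, -1, 1, 0, 0;
     0, -6, 0, -3 * γ, 3, 3 * Real.sqrt 3;
     0, 0, 0, 0, -3 * Real.sqrt 3, 9]

/-- The single 6×6 Jordan block `J₆(η)`. -/
def J6 (η : ℝ) : Matrix (Fin 6) (Fin 6) ℝ :=
  !![η, 1, 0, 0, 0, 0;
     0, η, 1, 0, 0, 0;
     0, 0, η, 1, 0, 0;
     0, 0, 0, η, 1, 0;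
     0, 0, 0, 0, η, 1;
     0, 0, 0, 0, 0, η]

/-- The superdiagonal matrix with entries `1, 1, 1, c, 1`. -/
def weightedShift (c : ℝ) : Matrix (Fin 6) (Fin 6) ℝ :=
  !![0, 1, 0, 0, 0, 0;
     0, 0, 1, 0, 0, 0;
     0, 0, 0, 1, 0, 0;
     0, 0, 0, 0, c, 0;
     0, 0, 0, 0, 0, 1;
     0, 0, 0, 0, 0, 0]

/-- A `γ`-independent basis, stored as columns, in which `Emat γ` becomes superdiagonal. -/
noncomputable def chainBasis : Matrix (Fin 6) (Fin 6) ℝ :=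
  !![-162 * √3, 18 * √3, 0, 0, 0, 0;
     -486, 0, 6, 0, 0, 0;
     0, 0, 0, 0, -1, 1;
     0, 0, 0, 0, -1, 0;
     -486, -54, 3, 1, 0, 0;
     -162 * √3, -36 * √3, -3 * √3, 0, 0, 0]

/-- The inverse of `chainBasis`. -/
noncomputable def chainBasisInv : Matrix (Fin 6) (Fin 6) ℝ :=
  !![-2 * √3 / 2187, -1 / 1458, 0, 0, 0, -√3 / 2187;
     5 * √3 / 486, -1 / 162, 0, 0, 0, -√3 / 243;
     -2 * √3 / 27, 1 / 9, 0, 0, 0, -√3 / 27;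
     √3 / 3, -1, 0, 0, 1, -√3 / 3;
     0, 0, 0, -1, 0, 0;
     0, 0, 1, -1, 0, 0]

theorem chainBasis_mul_inv : chainBasis * chainBasisInv = 1 := by
  have h : √3 * √3 = (3 : ℝ) := Real.mul_self_sqrt (by norm_num)
  ext i j
  fin_cases i <;> fin_cases j <;>
    simp [chainBasis, chainBasisInv, Matrix.mul_apply, Fin.sum_univ_six] <;> grind

theorem Emat_mul_chainBasis (γ : ℝ) :
    Emat γ * chainBasis = chainBasis * weightedShift (3 * γ) := by
  have h : √3 * √3 = (3 : ℝ) := Real.mul_self_sqrt (by norm_num)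
  ext i j
  fin_cases i <;> fin_cases j <;>
    simp [Emat, chainBasis, weightedShift, Matrix.mul_apply, Fin.sum_univ_six] <;> grind

theorem isUnit_det_chainBasis : IsUnit chainBasis.det :=
  Matrix.isUnit_det_of_right_inverse chainBasis_mul_inv

theorem Emat_eq_conj (γ : ℝ) :
    Emat γ = chainBasis * weightedShift (3 * γ) * chainBasis⁻¹ := by
  rw [← Emat_mul_chainBasis, Matrix.mul_nonsing_inv_cancel_right _ _ isUnit_det_chainBasis]

theorem Emat_pow_eq_zero_iff (γ : ℝ) (n : ℕ) :
    Emat γ ^ n = 0 ↔ weightedShift (3 * γ) ^ n = 0 := by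
  have hu : IsUnit chainBasis := (Matrix.isUnit_iff_isUnit_det _).2 isUnit_det_chainBasis
  have h : Emat γ ^ n * chainBasis = chainBasis * weightedShift (3 * γ) ^ n :=
    (SemiconjBy.pow_right (Emat_mul_chainBasis γ).symm n).symm
  rw [← hu.mul_left_eq_zero, h, hu.mul_right_eq_zero]

theorem weightedShift_pow_four (c : ℝ) :
    weightedShift c ^ 4 =
      !![0, 0, 0, 0, c, 0;
         0, 0, 0, 0, 0, c;
         0, 0, 0, 0, 0, 0;
         0, 0, 0, 0, 0, 0;
         0, 0, 0, 0, 0, 0;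
         0, 0, 0, 0, 0, 0] := by
  ext i j
  fin_cases i <;> fin_cases j <;>
    simp [weightedShift, pow_succ, Matrix.mul_apply, Fin.sum_univ_six]

/-- `weightedShift c` is a cyclic permutation with rows rescaled by `1, 1, 1, c, 1, 0`. -/
theorem weightedShift_eq_diagonal_mul (c : ℝ) :
    weightedShift c =
      Matrix.diagonal ![1, 1, 1, c, 1, 0] * (finRotate 6).permMatrix ℝ := by
  ext i j
  fin_cases i <;> fin_cases j <;>
    simp [weightedShift, Equiv.Perm.permMatrix, PEquiv.toMatrix_apply]

theorem rank_Emat (γ : ℝ) :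
    (Emat γ).rank = Fintype.card {i // (![1, 1, 1, 3 * γ, 1, 0] : Fin 6 → ℝ) i ≠ 0} := by
  rw [Emat_eq_conj, Matrix.rank_mul_eq_left_of_isUnit_det,
    Matrix.rank_mul_eq_right_of_isUnit_det _ _ isUnit_det_chainBasis,
    weightedShift_eq_diagonal_mul, Matrix.rank_mul_eq_left_of_isUnit_det, Matrix.rank_diagonal]
  · simp [Matrix.det_permutation]
  · exact Matrix.isUnit_nonsing_inv_det _ isUnit_det_chainBasis

theorem J6_similar_weightedShift (c : ℝ) :
    Matrix.diagonal ![c, c, c, c, 1, 1] * J6 0 =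
      weightedShift c * Matrix.diagonal ![c, c, c, c, 1, 1] := by
  ext i j
  fin_cases i <;> fin_cases j <;> simp [J6, weightedShift]

/-- For `γ ≠ 0` the matrix `E(γ)` is similar to the single Jordan block `J₆(0)`, so
that `E(γ)⁶ = 0`, `E(γ)⁵ ≠ 0` and `rank E(γ) = 5` (geometric multiplicity 1), whereas
`E(0)⁴ = 0` and `rank E(0) = 4` (geometric multiplicity 2): the type of the
exceptional point changes abruptly from EP6 to EP4+EP2 in the limit `γ → 0`. -/
theorem Emat_EP6_to_EP4plusEP2 (γ : ℝ) (hγ : γ ≠ 0) :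
    (∃ P : Matrix (Fin 6) (Fin 6) ℝ, IsUnit P.det ∧ Emat γ = P * J6 0 * P⁻¹) ∧
    (Emat γ) ^ 6 = 0 ∧ (Emat γ) ^ 5 ≠ 0 ∧ (Emat γ).rank = 5 ∧
    (Emat 0) ^ 4 = 0 ∧ (Emat 0).rank = 4 := by
  refine ⟨⟨chainBasis * Matrix.diagonal ![3 * γ, 3 * γ, 3 * γ, 3 * γ, 1, 1], ?_, ?_⟩,
    ?_, ?_, ?_, ?_, ?_⟩
  · rw [Matrix.det_mul]
    exact isUnit_det_chainBasis.mul (by simp [Fin.prod_univ_six, hγ])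
  · have hD : IsUnit (Matrix.diagonal ![3 * γ, 3 * γ, 3 * γ, 3 * γ, 1, 1]).det := by
      simp [Fin.prod_univ_six, hγ]
    rw [Matrix.mul_assoc chainBasis, J6_similar_weightedShift, Matrix.mul_inv_rev,
      ← Matrix.mul_assoc, ← Matrix.mul_assoc,
      Matrix.mul_nonsing_inv_cancel_right _ _ hD, Emat_eq_conj]
  · rw [Emat_pow_eq_zero_iff, pow_add _ 4 2, weightedShift_pow_four]
    ext i j
    fin_cases i <;> fin_cases j <;>
      simp [weightedShift, pow_succ, Matrix.mul_apply, Fin.sum_univ_six]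
  · rw [Ne, Emat_pow_eq_zero_iff, pow_succ, weightedShift_pow_four]
    intro h
    simpa [weightedShift, Matrix.mul_apply, Fin.sum_univ_six, hγ] using congrFun₂ h 0 5
  · rw [rank_Emat, Fintype.card_subtype]
    simp [Finset.card_filter, Fin.sum_univ_six, hγ]
  · rw [Emat_pow_eq_zero_iff, weightedShift_pow_four]
    ext i j
    fin_cases i <;> fin_cases j <;> simp
  · rw [rank_Emat, Fintype.card_subtype]
    simp [Finset.card_filter, Fin.sum_univ_six]
end

section
/- Let H be an N×N complex matrix and let Θ be an N×N Hermitian positive-definite matrix satisfying H†·Θ = Θ·H. Then every eigenvalue of H is real. -/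
open Matrix ComplexOrder

/-- If `Θ` is a Hermitian positive-definite matrix and `H` is quasi-Hermitian with
respect to `Θ` (i.e. `H†·Θ = Θ·H`), then every eigenvalue of `H` is real. -/
theorem quasiHermitian_spectrum_real (N : ℕ)
    (H Θ : Matrix (Fin N) (Fin N) ℂ) (hΘ : Θ.PosDef)
    (hH : Hᴴ * Θ = Θ * H) :
    ∀ μ ∈ spectrum ℂ H, μ.im = 0 := by
  intro μ hμ
  rw [← Matrix.spectrum_toLin', ← Module.End.hasEigenvalue_iff_mem_spectrum] at hμ
  obtain ⟨x, hx⟩ := hμ.exists_hasEigenvector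
  have hHx : H *ᵥ x = μ • x := by simpa using hx.apply_eq_smul
  have hpos := hΘ.dotProduct_mulVec_pos hx.2
  -- Evaluate `⟨x, Hᴴ Θ x⟩ = ⟨x, Θ H x⟩` on both sides.
  have key : star μ * (star x ⬝ᵥ (Θ *ᵥ x)) = μ * (star x ⬝ᵥ (Θ *ᵥ x)) :=
    calc star μ * (star x ⬝ᵥ (Θ *ᵥ x))
        = star (H *ᵥ x) ⬝ᵥ (Θ *ᵥ x) := by
          rw [hHx, star_smul, smul_dotProduct, smul_eq_mul]
      _ = star x ⬝ᵥ ((Hᴴ * Θ) *ᵥ x) := by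
          rw [star_mulVec, ← dotProduct_mulVec, mulVec_mulVec]
      _ = μ * (star x ⬝ᵥ (Θ *ᵥ x)) := by
          rw [hH, ← mulVec_mulVec, hHx, mulVec_smul, dotProduct_smul, smul_eq_mul]
  exact Complex.conj_eq_iff_im.mp (mul_right_cancel₀ hpos.ne' key)
end
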